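/- arXiv:1808.04520 — 3 statements merged into one kernel-verified Lean document; each statement's English description precedes it below -/
import Mathlib

section
/- Let n be a positive integer and let π : GL₂(ℤ/nℤ) → ∏_{p ∣ n, p prime} PGL₂(ℤ/pℤ) be the natural homomorphism. Suppose N ⊴ G are subgroups of GL₂(ℤ/nℤ) with G/N isomorphic to PGL₂(ℤ/5ℤ). Then π(N) is a normal subgroup of π(G) and the quotient π(G)/π(N) is isomorphic to PGL₂(ℤ/5ℤ). -/
open scoped MatrixGroups

/-- `PGL₂(R)`: the quotient of `GL₂(R)` by its center. -/
abbrev PGL2 (R : Type*) [CommRing R] : Type _ :=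
  GL (Fin 2) R ⧸ Subgroup.center (GL (Fin 2) R)

/-- The natural homomorphism `GL₂(ℤ/nℤ) → ∏_{p ∣ n, p prime} PGL₂(ℤ/pℤ)` obtained by
reducing modulo each prime `p` dividing `n` and passing to the quotient by the center. -/
def glToPGLProd (n : ℕ) :
    GL (Fin 2) (ZMod n) →* ∀ p : n.primeFactors, PGL2 (ZMod (p : ℕ)) :=
  Pi.monoidHom fun p =>
    (QuotientGroup.mk' (Subgroup.center (GL (Fin 2) (ZMod (p : ℕ))))).comp
      (Matrix.GeneralLinearGroup.map
        (ZMod.castHom (Nat.dvd_of_mem_primeFactors p.2) (ZMod (p : ℕ))))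
theorem Subgroup.exists_normal_nonempty_quotient_map_mulEquiv {Γ Δ : Type*} [Group Γ] [Group Δ]
    (φ : Γ →* Δ) {G N : Subgroup Γ} (hNG : N ≤ G) (hN : (N.subgroupOf G).Normal)
    (hker : φ.ker ⊓ G ≤ N) :
    ∃ hnormal : ((N.map φ).subgroupOf (G.map φ)).Normal,
      haveI := hnormal
      Nonempty ((G.map φ ⧸ (N.map φ).subgroupOf (G.map φ)) ≃* (G ⧸ N.subgroupOf G)) := by
  have hmap : (N.subgroupOf G).map (φ.subgroupMap G) = (N.map φ).subgroupOf (G.map φ) := by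
    ext ⟨y, hy⟩
    simp only [Subgroup.mem_map, Subgroup.mem_subgroupOf]
    constructor
    · rintro ⟨x, hx, h⟩
      exact ⟨x, hx, congrArg Subtype.val h⟩
    · rintro ⟨x, hx, h⟩
      exact ⟨⟨x, hNG hx⟩, hx, Subtype.ext h⟩
  have hnormal : ((N.map φ).subgroupOf (G.map φ)).Normal :=
    hmap ▸ hN.map _ (φ.subgroupMap_surjective G)
  refine ⟨hnormal, ?_⟩
  let ψ := (QuotientGroup.mk' ((N.map φ).subgroupOf (G.map φ))).comp (φ.subgroupMap G)
  have hψ : Function.Surjective ψ :=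
    (QuotientGroup.mk'_surjective _).comp (φ.subgroupMap_surjective G)
  have hkerψ : ψ.ker = N.subgroupOf G := by
    ext ⟨g, hg⟩
    simp only [ψ, MonoidHom.mem_ker, MonoidHom.comp_apply, QuotientGroup.mk'_apply,
      QuotientGroup.eq_one_iff, Subgroup.mem_subgroupOf, MonoidHom.subgroupMap_apply_coe,
      Subgroup.mem_map]
    constructor
    · rintro ⟨x, hx, h⟩
      have : x⁻¹ * g ∈ N :=
        hker ⟨by simp [h], G.mul_mem (G.inv_mem (hNG hx)) hg⟩
      simpa using mul_mem hx this
    · exact fun h ↦ ⟨g, h, rfl⟩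
  exact ⟨(QuotientGroup.quotientKerEquivOfSurjective ψ hψ).symm.trans
    (QuotientGroup.quotientMulEquivOfEq hkerψ)⟩

theorem MonoidHom.le_ker_of_commutator_le_ker {G P : Type*} [Group G] [Group P] {f : G →* P}
    (hf : Function.Surjective f)
    (hP : ∀ A : Subgroup P, A.Normal → (∀ a ∈ A, ∀ b ∈ A, a * b = b * a) → A = ⊥)
    {H : Subgroup G} [hH : H.Normal] (hcomm : ⁅H, H⁆ ≤ f.ker) : H ≤ f.ker := by
  rw [← Subgroup.map_eq_bot_iff]
  refine hP _ (hH.map f hf) ?_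
  rintro _ ⟨a, ha, rfl⟩ _ ⟨b, hb, rfl⟩
  rw [← commutatorElement_eq_one_iff_mul_comm, ← map_commutatorElement]
  exact hcomm (Subgroup.commutator_mem_commutator ha hb)

set_option synthInstance.maxSize 2000 in
/-- If a matrix over `𝔽₅` commutes up to scalars with three suitable conjugates, it is scalar. -/
theorem scalar_of_commute_transvection_conj : ∀ a b c d : ZMod 5, a * d - b * c ≠ 0 →
    (∀ h ∈ [((1 : ZMod 5), (0 : ZMod 5)), (2, 0), (0, 1)], ∃ u : ZMod 5,
      let h₁ : Matrix (Fin 2) (Fin 2) (ZMod 5) := !![1, h.1; h.2, 1]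
      let h₂ : Matrix (Fin 2) (Fin 2) (ZMod 5) := !![1, -h.1; -h.2, 1]
      !![a, b; c, d] * (h₁ * !![a, b; c, d] * h₂) =
        (h₁ * !![a, b; c, d] * h₂) * !![a, b; c, d] * !![u, 0; 0, u]) →
    b = 0 ∧ c = 0 ∧ a = d := by
  simp only [List.forall_mem_cons, Matrix.mul_fin_two, List.not_mem_nil, false_imp_iff,
    implies_true, and_true, one_mul, mul_one, zero_mul, mul_zero,
    neg_zero, add_zero, zero_add,
    EmbeddingLike.apply_eq_iff_eq, Matrix.vecCons_inj]
  decide +kernel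

theorem PGL2.eq_bot_of_normal_of_commute (A : Subgroup (PGL2 (ZMod 5))) (hA : A.Normal)
    (hcomm : ∀ a ∈ A, ∀ b ∈ A, a * b = b * a) : A = ⊥ := by
  rw [eq_bot_iff]
  intro x hx
  obtain ⟨g, rfl⟩ := QuotientGroup.mk_surjective x
  rw [Subgroup.mem_bot, QuotientGroup.eq_one_iff,
    Matrix.GeneralLinearGroup.mem_center_iff_val_mem_range_scalar]
  have key (h : GL (Fin 2) (ZMod 5)) : ∃ u : ZMod 5,
      g.val * (h.val * g.val * h⁻¹.val) =
        (h.val * g.val * h⁻¹.val) * g.val * !![u, 0; 0, u] := by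
    have hc := hcomm _ hx _ (hA.conj_mem _ hx (h : PGL2 (ZMod 5)))
    have hc' : (((h * g * h⁻¹) * g : GL (Fin 2) (ZMod 5)) : PGL2 (ZMod 5)) =
      ((g * (h * g * h⁻¹) : GL (Fin 2) (ZMod 5)) : PGL2 (ZMod 5)) := hc.symm
    rw [QuotientGroup.eq, Matrix.GeneralLinearGroup.mem_center_iff_val_mem_range_scalar] at hc'
    obtain ⟨u, hu⟩ := hc'
    refine ⟨u, ?_⟩
    have hu' : (!![u, 0; 0, u] : Matrix (Fin 2) (Fin 2) (ZMod 5)) = Matrix.scalar (Fin 2) u := by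
      ext i j; fin_cases i <;> fin_cases j <;> simp
    rw [hu', hu]
    simp only [← Units.val_mul, mul_inv_cancel_left]
  have : Fact (Nat.Prime 5) := ⟨Nat.prime_five⟩
  have hdet : g.val.det ≠ 0 := (Matrix.isUnits_det_units g).ne_zero
  rw [Matrix.det_fin_two] at hdet
  obtain ⟨h₁, h₂, h₃⟩ := scalar_of_commute_transvection_conj _ _ _ _ hdet <| by
    intro h hh
    have hmul : h.1 * h.2 = 0 := by fin_cases hh <;> simp
    obtain ⟨u, hu⟩ := key ⟨!![1, h.1; h.2, 1], !![1, -h.1; -h.2, 1],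
      by rw [Matrix.mul_fin_two, Matrix.one_fin_two]; simp [hmul, mul_comm h.2],
      by rw [Matrix.mul_fin_two, Matrix.one_fin_two]; simp [hmul, mul_comm h.2]⟩
    rw [Matrix.eta_fin_two g.val] at hu
    exact ⟨u, hu⟩
  refine ⟨g.val 0 0, ?_⟩
  ext i j
  fin_cases i <;> fin_cases j <;> simp [h₁, h₂, h₃]

namespace Matrix.GeneralLinearGroup

variable {n R : Type*} [Fintype n] [DecidableEq n] [CommRing R]

theorem mem_ker_map_mk_iff (I : Ideal R) (g : GL n R) :
    g ∈ (map (n := n) (Ideal.Quotient.mk I)).ker ↔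
      ∀ i j, g.val i j - (1 : Matrix n n R) i j ∈ I := by
  simp only [MonoidHom.mem_ker, Units.ext_iff, ← Matrix.ext_iff, ← Ideal.Quotient.eq_zero_iff_mem,
    map_sub, sub_eq_zero]
  refine forall₂_congr fun i j ↦ ?_
  rw [Units.val_one, Matrix.one_apply, Matrix.one_apply, apply_ite (Ideal.Quotient.mk I), map_one,
    map_zero]
  rfl

theorem commutator_ker_map_mk_le {I J : Ideal R} :
    ⁅(map (n := n) (Ideal.Quotient.mk I)).ker, (map (n := n) (Ideal.Quotient.mk J)).ker⁆ ≤
      (map (n := n) (Ideal.Quotient.mk (I * J))).ker := by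
  rw [Subgroup.commutator_le]
  intro g hg h hh
  rw [mem_ker_map_mk_iff] at hg hh
  rw [MonoidHom.mem_ker, map_commutatorElement, commutatorElement_eq_one_iff_mul_comm, ← map_mul,
    ← map_mul]
  ext i j
  change Ideal.Quotient.mk _ ((g.val * h.val) i j) = Ideal.Quotient.mk _ ((h.val * g.val) i j)
  rw [Ideal.Quotient.eq, ← Matrix.sub_apply,
    show g.val * h.val - h.val * g.val = (g.val - 1) * (h.val - 1) - (h.val - 1) * (g.val - 1) by
      noncomm_ring, Matrix.sub_apply, Matrix.mul_apply, Matrix.mul_apply]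
  refine sub_mem (sum_mem fun k _ ↦ Ideal.mul_mem_mul (hg i k) (hh k j)) (sum_mem fun k _ ↦ ?_)
  rw [mul_comm ((h.val - 1) i k)]
  exact Ideal.mul_mem_mul (hg k j) (hh i k)

theorem ker_map_mk_mono {I J : Ideal R} (hIJ : I ≤ J) :
    (map (n := n) (Ideal.Quotient.mk I)).ker ≤ (map (n := n) (Ideal.Quotient.mk J)).ker := by
  intro g hg
  rw [mem_ker_map_mk_iff] at hg ⊢
  exact fun i j ↦ hIJ (hg i j)

end Matrix.GeneralLinearGroup

theorem ZMod.isNilpotent_of_castHom_eq_zero {n : ℕ} [NeZero n] {x : ZMod n}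
    (hx : ∀ p : n.primeFactors,
      ZMod.castHom (Nat.dvd_of_mem_primeFactors p.2) (ZMod (p : ℕ)) x = 0) :
    IsNilpotent x := by
  refine ⟨n, ?_⟩
  rw [← ZMod.natCast_zmod_val x, ← Nat.cast_pow, ZMod.natCast_eq_zero_iff]
  refine (Nat.dvd_prod_primeFactors_pow_self (NeZero.ne n)).trans (pow_dvd_pow_of_dvd ?_ n)
  refine Finset.prod_primes_dvd _ (fun p hp ↦ (Nat.prime_of_mem_primeFactors hp).prime) ?_
  intro p hp
  have h := hx ⟨p, hp⟩
  rw [← ZMod.natCast_zmod_val x, map_natCast, ZMod.natCast_eq_zero_iff] at h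
  exact h

open scoped commutatorElement in
theorem commutator_ker_glToPGLProd_le (n : ℕ) [NeZero n] :
    ⁅(glToPGLProd n).ker, (glToPGLProd n).ker⁆ ≤
      (Matrix.GeneralLinearGroup.map (n := Fin 2)
        (Ideal.Quotient.mk (nilradical (ZMod n)))).ker := by
  rw [Subgroup.commutator_le]
  intro g hg h _
  rw [Matrix.GeneralLinearGroup.mem_ker_map_mk_iff]
  intro i j
  refine ZMod.isNilpotent_of_castHom_eq_zero fun p ↦ ?_
  have hgp : Matrix.GeneralLinearGroup.map
      (ZMod.castHom (Nat.dvd_of_mem_primeFactors p.2) (ZMod (p : ℕ))) g ∈ Subgroup.center _ :=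
    (QuotientGroup.eq_one_iff _).mp (congrFun hg p)
  have hc : Matrix.GeneralLinearGroup.map
      (ZMod.castHom (Nat.dvd_of_mem_primeFactors p.2) (ZMod (p : ℕ))) ⁅g, h⁆ = 1 := by
    rw [map_commutatorElement, commutatorElement_eq_one_iff_mul_comm]
    exact (Subgroup.mem_center_iff.mp hgp _).symm
  have hij := congrArg (fun u ↦ u.val i j) hc
  rw [map_sub, sub_eq_zero]
  refine hij.trans ?_
  rw [Units.val_one, Matrix.one_apply, Matrix.one_apply, apply_ite (ZMod.castHom _ _), map_one,
    map_zero]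

/-- A homomorphism from a subgroup of `GL₂(ℤ/nℤ)` onto a group without nontrivial abelian normal
subgroups kills everything that becomes scalar modulo each prime divisor of `n`. -/
theorem subgroupOf_ker_glToPGLProd_le_ker {n : ℕ} [NeZero n] {P : Type*} [Group P]
    (hP : ∀ A : Subgroup P, A.Normal → (∀ a ∈ A, ∀ b ∈ A, a * b = b * a) → A = ⊥)
    {G : Subgroup (GL (Fin 2) (ZMod n))} {f : G →* P} (hf : Function.Surjective f) :
    (glToPGLProd n).ker.subgroupOf G ≤ f.ker := by
  have step {H L : Subgroup (GL (Fin 2) (ZMod n))} [H.Normal] (hHL : ⁅H, H⁆ ≤ L)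
      (hL : L.subgroupOf G ≤ f.ker) : H.subgroupOf G ≤ f.ker := by
    refine MonoidHom.le_ker_of_commutator_le_ker hf hP (le_trans ?_ hL)
    rw [Subgroup.commutator_le]
    exact fun a ha b hb ↦ hHL (Subgroup.commutator_mem_commutator ha hb)
  let K (k : ℕ) := (Matrix.GeneralLinearGroup.map (n := Fin 2)
    (Ideal.Quotient.mk (nilradical (ZMod n) ^ k))).ker
  obtain ⟨m, hm⟩ := IsNoetherianRing.isNilpotent_nilradical (ZMod n)
  have hKmono {k l : ℕ} (hkl : k ≤ l) : K l ≤ K k := 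
    Matrix.GeneralLinearGroup.ker_map_mk_mono (Ideal.pow_le_pow_right hkl)
  have hKm : K (m + 1) = ⊥ := by
    rw [eq_bot_iff]
    intro g hg
    have hg' := hKmono m.le_succ hg
    rw [Matrix.GeneralLinearGroup.mem_ker_map_mk_iff, hm] at hg'
    ext i j
    exact sub_eq_zero.mp (hg' i j)
  have hK : (K 1).subgroupOf G ≤ f.ker := by
    refine Nat.decreasingInduction' (m := 1) (n := m + 1)
      (P := fun k ↦ (K k).subgroupOf G ≤ f.ker) (fun k _ hk ih ↦ step ?_ ih) (by lia) ?_
    · refine Matrix.GeneralLinearGroup.commutator_ker_map_mk_le.trans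
        (Matrix.GeneralLinearGroup.ker_map_mk_mono ?_)
      rw [← pow_add]
      exact Ideal.pow_le_pow_right (by lia)
    · simp [hKm]
  exact step ((commutator_ker_glToPGLProd_le n).trans
    (Matrix.GeneralLinearGroup.ker_map_mk_mono (pow_one _).ge)) hK

/-- If `N ⊴ G` are subgroups of `GL₂(ℤ/nℤ)` with `G/N ≅ PGL₂(ℤ/5ℤ)`, then
`π(N)` is normal in `π(G)` and `π(G)/π(N) ≅ PGL₂(ℤ/5ℤ)`, where `π` is the natural map to
`∏_{p ∣ n, p prime} PGL₂(ℤ/pℤ)`. -/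
theorem pgl2_quotient_of_image (n : ℕ) (hn : 0 < n)
    (G N : Subgroup (GL (Fin 2) (ZMod n))) (hNG : N ≤ G)
    (hN : (N.subgroupOf G).Normal)
    (hiso : Nonempty ((G ⧸ N.subgroupOf G) ≃* PGL2 (ZMod 5))) :
    ∃ hnormal : ((N.map (glToPGLProd n)).subgroupOf (G.map (glToPGLProd n))).Normal,
      haveI := hnormal
      Nonempty
        ((G.map (glToPGLProd n) ⧸ (N.map (glToPGLProd n)).subgroupOf (G.map (glToPGLProd n)))
          ≃* PGL2 (ZMod 5)) := by
  have : NeZero n := ⟨hn.ne'⟩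
  obtain ⟨e⟩ := hiso
  let f : G →* PGL2 (ZMod 5) := e.toMonoidHom.comp (QuotientGroup.mk' (N.subgroupOf G))
  have hf : Function.Surjective f := e.surjective.comp (QuotientGroup.mk'_surjective _)
  have hker : (glToPGLProd n).ker ⊓ G ≤ N := by
    rintro g ⟨hg, hgG⟩
    have hfg : e (QuotientGroup.mk' (N.subgroupOf G) ⟨g, hgG⟩) = 1 :=
      subgroupOf_ker_glToPGLProd_le_ker PGL2.eq_bot_of_normal_of_commute hf
        (show (⟨g, hgG⟩ : G) ∈ (glToPGLProd n).ker.subgroupOf G from hg)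
    rw [map_eq_one_iff e e.injective] at hfg
    exact (QuotientGroup.eq_one_iff (⟨g, hgG⟩ : G)).mp hfg
  obtain ⟨hnormal, ⟨e'⟩⟩ :=
    Subgroup.exists_normal_nonempty_quotient_map_mulEquiv (glToPGLProd n) hNG hN hker
  exact ⟨hnormal, ⟨e'.trans e⟩⟩
end

section
/- Let T be a finite set of primes. If the product ∏_{p ∈ T} PGL₂(ℤ/pℤ) has a subquotient isomorphic to PGL₂(ℤ/5ℤ), then there exists a prime p ∈ T such that PGL₂(ℤ/pℤ) has a subquotient isomorphic to PGL₂(ℤ/5ℤ). -/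
open scoped MatrixGroups

/-- A group `Q` is a subquotient of `Γ` if there are subgroups `N ⊴ G ≤ Γ` with `G/N ≅ Q`. -/
def IsSubquotient (Γ : Type*) [Group Γ] (Q : Type*) [Group Q] : Prop :=
  ∃ (G : Subgroup Γ) (N : Subgroup G) (hN : N.Normal),
    haveI := hN
    Nonempty ((G ⧸ N) ≃* Q)

section Subquotient

variable {G Γ Q : Type*} [Group G] [Group Γ] [Group Q]

theorem isSubquotient_of_ker_le (f : G →* Γ) (φ : G →* Q) (hφ : Function.Surjective φ)
    (h : f.ker ≤ φ.ker) : IsSubquotient Γ Q := by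
  have hN : (φ.ker.map f.rangeRestrict).Normal :=
    Subgroup.Normal.map inferInstance _ f.rangeRestrict_surjective
  refine ⟨f.range, φ.ker.map f.rangeRestrict, hN, ?_⟩
  let ψ : G →* f.range ⧸ φ.ker.map f.rangeRestrict :=
    (QuotientGroup.mk' _).comp f.rangeRestrict
  have hψ : Function.Surjective ψ :=
    (QuotientGroup.mk'_surjective _).comp f.rangeRestrict_surjective
  have hker : ψ.ker = φ.ker := by
    rw [← MonoidHom.comap_ker, QuotientGroup.ker_mk', Subgroup.comap_map_eq,
      MonoidHom.ker_rangeRestrict, sup_eq_left.mpr h]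
  exact ⟨(QuotientGroup.quotientKerEquivOfSurjective ψ hψ).symm.trans
    ((QuotientGroup.quotientMulEquivOfEq hker).trans
      (QuotientGroup.quotientKerEquivOfSurjective φ hφ))⟩

/-- If any two nontrivial normal subgroups of `Q` have nontrivial commutator, then a surjection
onto `Q` which is nontrivial on each of finitely many normal subgroups is nontrivial on their
intersection. -/
theorem map_finset_inf_ne_bot [Nontrivial Q]
    (hQ : ∀ M N : Subgroup Q, M.Normal → N.Normal → M ≠ ⊥ → N ≠ ⊥ → ⁅M, N⁆ ≠ ⊥)
    (φ : G →* Q) (hφ : Function.Surjective φ) {ι : Type*} (s : Finset ι) (K : ι → Subgroup G)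
    (hK : ∀ i, (K i).Normal) (hne : ∀ i, (K i).map φ ≠ ⊥) :
    (s.inf K).Normal ∧ (s.inf K).map φ ≠ ⊥ := by
  classical
  induction s using Finset.induction_on with
  | empty =>
    rw [Finset.inf_empty, Subgroup.map_top_of_surjective φ hφ]
    exact ⟨inferInstance, top_ne_bot⟩
  | insert i s _ ih =>
    obtain ⟨hn, hs⟩ := ih
    have := hK i
    rw [Finset.inf_insert]
    refine ⟨inferInstance, fun h => ?_⟩
    apply hQ _ _ ((hK i).map φ hφ) (hn.map φ hφ) (hne i) hs
    rw [← Subgroup.map_commutator, eq_bot_iff, ← h]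
    exact Subgroup.map_mono (Subgroup.commutator_le_inf _ _)

/-- If any two nontrivial normal subgroups of `Q` have nontrivial commutator and `Q` is a
subquotient of a finite product, then `Q` is a subquotient of one of the factors. -/
theorem exists_isSubquotient_of_pi [Nontrivial Q]
    (hQ : ∀ M N : Subgroup Q, M.Normal → N.Normal → M ≠ ⊥ → N ≠ ⊥ → ⁅M, N⁆ ≠ ⊥)
    {ι : Type*} [Finite ι] {Γ : ι → Type*} [∀ i, Group (Γ i)]
    (h : IsSubquotient (∀ i, Γ i) Q) : ∃ i, IsSubquotient (Γ i) Q := by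
  have := Fintype.ofFinite ι
  obtain ⟨G, N, hN, ⟨e⟩⟩ := h
  let φ : G →* Q := e.toMonoidHom.comp (QuotientGroup.mk' N)
  have hφ : Function.Surjective φ := e.surjective.comp (QuotientGroup.mk'_surjective N)
  let f : ∀ i, G →* Γ i := fun i => (Pi.evalMonoidHom Γ i).comp G.subtype
  by_contra! hcon
  refine (map_finset_inf_ne_bot hQ φ hφ Finset.univ (fun i => (f i).ker)
    (fun i => inferInstance) fun i hi => hcon i ?_).2 ?_
  · exact isSubquotient_of_ker_le (f i) φ hφ ((Subgroup.map_eq_bot_iff _).mp hi)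
  · have hbot : Finset.univ.inf (fun i => (f i).ker) = ⊥ := by
      rw [eq_bot_iff]
      intro g hg
      rw [Subgroup.mem_bot]
      ext i
      exact Finset.inf_le (f := fun i => (f i).ker) (Finset.mem_univ i) hg
    rw [hbot, Subgroup.map_bot]

end Subquotient

section GL2

open Matrix

variable {K : Type*} [Field K]

/-- The invertible matrix with entries `a, b; c, d`. -/
def gl2 (a b c d : K) (h : a * d - b * c ≠ 0) : GL (Fin 2) K :=
  Matrix.GeneralLinearGroup.mkOfDetNeZero !![a, b; c, d] (by rwa [Matrix.det_fin_two_of])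

@[simp]
theorem coe_gl2 (a b c d : K) (h : a * d - b * c ≠ 0) :
    (gl2 a b c d h : Matrix (Fin 2) (Fin 2) K) = !![a, b; c, d] := rfl

theorem exists_eq_gl2 (m : GL (Fin 2) K) : ∃ a b c d h, m = gl2 a b c d h := by
  refine ⟨m 0 0, m 0 1, m 1 0, m 1 1, ?_, ?_⟩
  · rw [← Matrix.det_fin_two]
    exact Matrix.GeneralLinearGroup.det_ne_zero m
  · exact Units.ext (Matrix.eta_fin_two _)

theorem gl2_mul_gl2 {a b c d a' b' c' d' : K} (h h') :
    gl2 a b c d h * gl2 a' b' c' d' h' =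
      gl2 (a * a' + b * c') (a * b' + b * d') (c * a' + d * c') (c * b' + d * d')
        (by convert mul_ne_zero h h' using 1; ring) :=
  Units.ext (by simp)

theorem gl2_inj {a b c d a' b' c' d' : K} (h h') :
    gl2 a b c d h = gl2 a' b' c' d' h' ↔ a = a' ∧ b = b' ∧ c = c' ∧ d = d' := by
  refine ⟨fun e => ?_, ?_⟩
  · have e' := congrArg (Units.val) e
    exact ⟨congrFun₂ e' 0 0, congrFun₂ e' 0 1, congrFun₂ e' 1 0, congrFun₂ e' 1 1⟩
  · rintro ⟨rfl, rfl, rfl, rfl⟩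
    rfl

theorem gl2_mem_center_iff {a b c d : K} (h) :
    gl2 a b c d h ∈ Subgroup.center (GL (Fin 2) K) ↔ a = d ∧ b = 0 ∧ c = 0 := by
  rw [Matrix.GeneralLinearGroup.mem_center_iff_val_mem_range_scalar]
  constructor
  · rintro ⟨r, hr⟩
    have h00 := congrFun₂ hr 0 0
    have h01 := congrFun₂ hr 0 1
    have h10 := congrFun₂ hr 1 0
    have h11 := congrFun₂ hr 1 1
    simp only [coe_gl2, scalar_apply, diagonal_apply, of_apply, cons_val', cons_val_zero,
      cons_val_one, cons_val_fin_one, if_true, if_false, one_ne_zero, zero_ne_one]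
      at h00 h01 h10 h11
    exact ⟨h00.symm.trans h11, h01.symm, h10.symm⟩
  · rintro ⟨rfl, rfl, rfl⟩
    refine ⟨a, ?_⟩
    ext i j
    fin_cases i <;> fin_cases j <;> simp

theorem Subgroup.Normal.mem_of_mul_eq_mul {G : Type*} [Group G] {H : Subgroup G} (hH : H.Normal)
    {a b : G} (ha : a ∈ H) (g : G) (h : g * a = b * g) : b ∈ H := by
  have := hH.conj_mem a ha g
  rwa [h, mul_inv_cancel_right] at this

variable {H : Subgroup (GL (Fin 2) K)}

theorem exists_lower_left_ne_zero_mem (hH : H.Normal)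
    (hc : ¬ H ≤ Subgroup.center (GL (Fin 2) K)) :
    ∃ a b c d h, c ≠ 0 ∧ gl2 a b c d h ∈ H := by
  obtain ⟨m, hm, hmc⟩ := SetLike.not_le_iff_exists.mp hc
  obtain ⟨a, b, c, d, h, rfl⟩ := exists_eq_gl2 m
  rw [gl2_mem_center_iff] at hmc
  by_cases c0 : c = 0
  · subst c0
    by_cases b0 : b = 0
    · subst b0
      refine ⟨a, 0, a - d, d, by simpa using h, fun e => hmc ⟨sub_eq_zero.mp e, rfl, rfl⟩, ?_⟩
      refine hH.mem_of_mul_eq_mul hm (gl2 1 0 1 1 (by simp)) ?_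
      rw [gl2_mul_gl2, gl2_mul_gl2, gl2_inj]
      refine ⟨?_, ?_, ?_, ?_⟩ <;> ring
    · refine ⟨d, 0, b, a, by simpa [mul_comm] using h, b0, ?_⟩
      refine hH.mem_of_mul_eq_mul hm (gl2 0 1 1 0 (by simp)) ?_
      rw [gl2_mul_gl2, gl2_mul_gl2, gl2_inj]
      refine ⟨?_, ?_, ?_, ?_⟩ <;> ring
  · exact ⟨a, b, c, d, h, c0, hm⟩

theorem exists_companion_mem (hH : H.Normal) (hc : ¬ H ≤ Subgroup.center (GL (Fin 2) K)) :
    ∃ b d h, gl2 0 b 1 d h ∈ H := by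
  obtain ⟨a, b, c, d, h, c0, hm⟩ := exists_lower_left_ne_zero_mem hH hc
  refine ⟨b * c - a * d, a + d, fun e => h (by linear_combination e), ?_⟩
  refine hH.mem_of_mul_eq_mul hm (gl2 c (-a) 0 1 (by simpa using c0)) ?_
  rw [gl2_mul_gl2, gl2_mul_gl2, gl2_inj]
  refine ⟨?_, ?_, ?_, ?_⟩ <;> ring

/-- A noncentral normal subgroup of `GL₂(K)` contains the elementary matrices, provided that `K`
has more than three elements. -/
theorem elementary_mem_of_not_le_center {x : K} (hx : x ≠ 0) (hx2 : x ^ 2 ≠ 1)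
    (hH : H.Normal) (hc : ¬ H ≤ Subgroup.center (GL (Fin 2) K)) :
    gl2 1 0 1 1 (by simp) ∈ H ∧ gl2 1 1 0 1 (by simp) ∈ H := by
  obtain ⟨b, d, hb, hm⟩ := exists_companion_mem hH hc
  have b0 : b ≠ 0 := by simpa using hb
  have hm' : gl2 0 (x * b) x⁻¹ d (by simp [hx, b0]) ∈ H := by
    refine hH.mem_of_mul_eq_mul hm (gl2 x 0 0 1 (by simpa using hx)) ?_
    rw [gl2_mul_gl2, gl2_mul_gl2, gl2_inj]
    refine ⟨?_, ?_, ?_, ?_⟩ <;> field_simp <;> ring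
  obtain ⟨s, ht⟩ : ∃ s, gl2 x 0 s x⁻¹ (by simp [hx]) ∈ H := by
    refine ⟨(1 - x⁻¹) * d / b, ?_⟩
    rw [← H.mul_mem_cancel_right hm, gl2_mul_gl2]
    convert hm' using 1
    rw [gl2_inj]
    refine ⟨?_, ?_, ?_, ?_⟩ <;> field_simp <;> ring
  have r0 : x - x⁻¹ ≠ 0 := by
    intro e
    apply hx2
    field_simp at e
    linear_combination e
  have ht' : gl2 x 0 (s + (x - x⁻¹)) x⁻¹ (by simp [hx]) ∈ H := by
    refine hH.mem_of_mul_eq_mul ht (gl2 1 0 1 1 (by simp)) ?_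
    rw [gl2_mul_gl2, gl2_mul_gl2, gl2_inj]
    refine ⟨?_, ?_, ?_, ?_⟩ <;> ring
  have hr : gl2 1 0 ((x - x⁻¹) * x⁻¹) 1 (by simp) ∈ H := by
    rw [← H.mul_mem_cancel_right ht, gl2_mul_gl2]
    convert ht' using 1
    rw [gl2_inj]
    refine ⟨?_, ?_, ?_, ?_⟩ <;> field_simp <;> ring
  have hl : gl2 1 0 1 1 (by simp) ∈ H := by
    refine hH.mem_of_mul_eq_mul hr (gl2 ((x - x⁻¹) * x⁻¹) 0 0 1 (by simp [hx, r0])) ?_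
    rw [gl2_mul_gl2, gl2_mul_gl2, gl2_inj]
    refine ⟨?_, ?_, ?_, ?_⟩ <;> ring
  refine ⟨hl, hH.mem_of_mul_eq_mul hl (gl2 0 1 1 0 (by simp)) ?_⟩
  rw [gl2_mul_gl2, gl2_mul_gl2, gl2_inj]
  refine ⟨?_, ?_, ?_, ?_⟩ <;> ring

theorem comap_mk'_not_le_center {M : Subgroup (PGL2 K)} (hM : M ≠ ⊥) :
    ¬ M.comap (QuotientGroup.mk' (Subgroup.center (GL (Fin 2) K))) ≤
      Subgroup.center (GL (Fin 2) K) := by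
  intro h
  apply hM
  rw [eq_bot_iff, ← Subgroup.map_comap_eq_self_of_surjective (QuotientGroup.mk'_surjective _) M,
    Subgroup.map_le_iff_le_comap, MonoidHom.comap_bot, QuotientGroup.ker_mk']
  exact h

theorem commutator_ne_bot_of_normal_PGL2 {x : K} (hx : x ≠ 0) (hx2 : x ^ 2 ≠ 1)
    (M N : Subgroup (PGL2 K)) (hM : M.Normal) (hN : N.Normal) (hM0 : M ≠ ⊥) (hN0 : N ≠ ⊥) :
    ⁅M, N⁆ ≠ ⊥ := by
  intro h
  have hl := (elementary_mem_of_not_le_center hx hx2 (hM.comap _)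
    (comap_mk'_not_le_center hM0)).1
  have hu := (elementary_mem_of_not_le_center hx hx2 (hN.comap _)
    (comap_mk'_not_le_center hN0)).2
  rw [Subgroup.mem_comap] at hl hu
  have hcomm := Subgroup.mem_centralizer_iff.mp
    (Subgroup.commutator_eq_bot_iff_le_centralizer.mp h hl) _ hu
  rw [← map_mul, ← map_mul, QuotientGroup.mk'_eq_mk'] at hcomm
  obtain ⟨z, hz, hzeq⟩ := hcomm
  obtain ⟨a, b, c, d, hdet, rfl⟩ := exists_eq_gl2 z
  obtain ⟨rfl, rfl, rfl⟩ := (gl2_mem_center_iff hdet).mp hz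
  simp only [gl2_mul_gl2, gl2_inj] at hzeq
  obtain ⟨h1, h2, -, -⟩ := hzeq
  exact one_ne_zero (α := K) (by linear_combination h1 - 2 * h2)

theorem nontrivial_PGL2 : Nontrivial (PGL2 K) := by
  refine ⟨QuotientGroup.mk (gl2 1 1 0 1 (by simp)), 1, fun h => ?_⟩
  rw [QuotientGroup.eq_one_iff, gl2_mem_center_iff] at h
  exact one_ne_zero h.2.1

end GL2

/-- Let `T` be a finite set of primes.  If `∏_{p ∈ T} PGL₂(ℤ/pℤ)` has a
subquotient isomorphic to `PGL₂(ℤ/5ℤ)`, then there is a prime `p ∈ T` such that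
`PGL₂(ℤ/pℤ)` has a subquotient isomorphic to `PGL₂(ℤ/5ℤ)`. -/
theorem pgl2_subquotient_of_prod (T : Finset ℕ) (hT : ∀ p ∈ T, p.Prime)
    (h : IsSubquotient (∀ p : T, PGL2 (ZMod (p : ℕ))) (PGL2 (ZMod 5))) :
    ∃ p ∈ T, IsSubquotient (PGL2 (ZMod p)) (PGL2 (ZMod 5)) := by
  have h2 : (2 : ZMod 5) ≠ 0 := by decide
  have h4 : (2 : ZMod 5) ^ 2 ≠ 1 := by decide
  have : Fact (Nat.Prime 5) := ⟨by norm_num⟩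
  have : Nontrivial (PGL2 (ZMod 5)) := nontrivial_PGL2
  have hQ := commutator_ne_bot_of_normal_PGL2 (K := ZMod 5) h2 h4
  obtain ⟨p, hp⟩ := exists_isSubquotient_of_pi hQ h
  exact ⟨p, p.2, hp⟩
end

section
/- Let p be a prime. If PGL₂(ℤ/pℤ) has a subquotient isomorphic to PGL₂(ℤ/5ℤ), then p = 5. -/
open scoped MatrixGroups

open Subgroup

section TwoByTwo

variable {F : Type*} [Field F]

/-- The centralizer of a nonscalar `2 × 2` matrix `A` is spanned by `1` and `A`. -/
lemma exists_eq_smul_one_add_smul_of_commute {A B : Matrix (Fin 2) (Fin 2) F}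
    (hA : ∀ c : F, A ≠ c • 1) (h : A * B = B * A) : ∃ a b : F, B = a • 1 + b • A := by
  have key : ∀ b : F, B 0 1 = b * A 0 1 → B 1 0 = b * A 1 0 →
      B 0 0 - B 1 1 = b * (A 0 0 - A 1 1) → ∃ a b : F, B = a • 1 + b • A := by
    intro b h01 h10 hd
    refine ⟨B 0 0 - b * A 0 0, b, ?_⟩
    ext i j
    fin_cases i <;> fin_cases j
    · simp
    · simpa using h01
    · simpa using h10
    · simp
      linear_combination -hd
  have e00 := congrFun (congrFun h 0) 0
  have e01 := congrFun (congrFun h 0) 1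
  have e10 := congrFun (congrFun h 1) 0
  simp only [Matrix.mul_apply, Fin.sum_univ_two] at e00 e01 e10
  by_cases h01 : A 0 1 = 0
  · by_cases h10 : A 1 0 = 0
    · have hd : A 0 0 - A 1 1 ≠ 0 := by
        intro hd
        refine hA (A 0 0) ?_
        ext i j
        fin_cases i <;> fin_cases j
        · simp
        · simpa using h01
        · simpa using h10
        · simp
          linear_combination -hd
      refine key ((B 0 0 - B 1 1) / (A 0 0 - A 1 1)) ?_ ?_ ?_
      · rw [h01, mul_zero]
        refine (mul_eq_zero.1 ?_).resolve_left hd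
        rw [h01] at e01
        linear_combination e01
      · rw [h10, mul_zero]
        refine (mul_eq_zero.1 ?_).resolve_left hd
        rw [h10] at e10
        linear_combination -e10
      · field_simp
    · refine key (B 1 0 / A 1 0) ?_ ?_ ?_ <;> field_simp
      · linear_combination -e00
      · linear_combination e10
  · refine key (B 0 1 / A 0 1) ?_ ?_ ?_ <;> field_simp
    · linear_combination e00
    · linear_combination -e01

lemma sq_eq_trace_smul_sub_det_smul_one (A : Matrix (Fin 2) (Fin 2) F) :
    A ^ 2 = A.trace • A - A.det • 1 := by
  ext i j
  fin_cases i <;> fin_cases j <;>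
    simp [pow_two, Matrix.mul_apply, Matrix.trace_fin_two, Matrix.det_fin_two] <;> ring

/-- If the characteristic polynomial of a `2 × 2` matrix `A` has vanishing discriminant, then
in characteristic `p` the matrix `A ^ p` is scalar. -/
lemma exists_pow_char_eq_smul_one {p : ℕ} [Fact p.Prime] [CharP F p]
    {A : Matrix (Fin 2) (Fin 2) F} (hA : A.trace ^ 2 = 4 * A.det) :
    ∃ c : F, A ^ p = c • 1 := by
  have hsq := sq_eq_trace_smul_sub_det_smul_one A
  rcases eq_or_ne (2 : F) 0 with h2 | h2
  · obtain rfl : p = 2 := by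
      refine (Nat.prime_dvd_prime_iff_eq Fact.out Nat.prime_two).1 ?_
      exact (CharP.cast_eq_zero_iff F p 2).1 (by exact_mod_cast h2)
    have ht : A.trace = 0 := by
      refine pow_eq_zero_iff (two_ne_zero) |>.1 ?_
      linear_combination hA + 2 * A.det * h2
    exact ⟨-A.det, by rw [hsq, ht]; simp⟩
  · set c : F := A.trace / 2 with hc
    have hN : (A - c • 1) ^ 2 = 0 := by
      have ht : A.trace = 2 * c := by rw [hc]; field_simp
      have hd : A.det = c ^ 2 := by
        rw [hc]
        field_simp
        linear_combination -hA
      rw [ht, hd] at hsq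
      have : (A - c • 1) ^ 2 = A ^ 2 - (2 * c) • A + (c ^ 2) • 1 := by
        simp only [pow_two, sub_mul, mul_sub, smul_mul_assoc, mul_smul_comm, one_mul, mul_one]
        module
      rw [this, hsq]
      module
    have hcomm : Commute (A - c • 1) (c • 1 : Matrix (Fin 2) (Fin 2) F) :=
      (Commute.one_right _).smul_right c
    have hp := add_pow_char_of_commute p hcomm
    rw [sub_add_cancel, pow_eq_zero_of_le (Fact.out : p.Prime).two_le hN, zero_add, smul_pow,
      one_pow] at hp
    exact ⟨c ^ p, hp⟩

/-- A matrix in the span of `1` and `A` with the same trace and determinant as `A` is, up to sign,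
`A` or its adjugate, provided that the characteristic polynomial of `A` is separable. -/
lemma smul_one_add_smul_cases {A : Matrix (Fin 2) (Fin 2) F} {a b : F}
    (hA : A.trace ^ 2 ≠ 4 * A.det) (ht : (a • 1 + b • A).trace = A.trace)
    (hd : (a • 1 + b • A).det = A.det) :
    (∃ c : F, a • 1 + b • A = c • A) ∨ ∃ c : F, a • 1 + b • A = c • A.adjugate := by
  have hadj : A.adjugate = A.trace • 1 - A := by
    ext i j
    fin_cases i <;> fin_cases j <;> simp [Matrix.adjugate_fin_two, Matrix.trace_fin_two]
  have ht' : 2 * a + b * A.trace = A.trace := by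
    simp only [Matrix.trace_fin_two, Matrix.add_apply, Matrix.smul_apply, Matrix.one_apply_eq,
      smul_eq_mul] at ht ⊢
    linear_combination ht
  have hd' : a ^ 2 + a * b * A.trace + b ^ 2 * A.det = A.det := by
    simp only [Matrix.trace_fin_two, Matrix.det_fin_two, Matrix.add_apply, Matrix.smul_apply,
      Matrix.one_apply, smul_eq_mul] at hd ⊢
    simp only [Fin.isValue, reduceIte, zero_ne_one, one_ne_zero, mul_zero, mul_one, zero_add] at hd
    linear_combination hd
  have hb : (1 - b) * (1 + b) = 0 := by
    refine (mul_eq_zero.1 ?_).resolve_left (sub_ne_zero.2 hA)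
    linear_combination 4 * hd' - (2 * a + b * A.trace + A.trace) * ht'
  rcases mul_eq_zero.1 hb with hb | hb
  · obtain rfl : b = 1 := (sub_eq_zero.1 hb).symm
    have : a * (a + A.trace) = 0 := by linear_combination hd'
    rcases mul_eq_zero.1 this with h | h
    · exact Or.inl ⟨1, by rw [h]; simp⟩
    · obtain rfl : a = -A.trace := eq_neg_of_add_eq_zero_left h
      exact Or.inr ⟨-1, by rw [hadj]; module⟩
  · obtain rfl : b = -1 := by linear_combination hb
    have : a * (a - A.trace) = 0 := by linear_combination hd'
    rcases mul_eq_zero.1 this with h | h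
    · exact Or.inl ⟨-1, by rw [h]; simp⟩
    · obtain rfl : a = A.trace := sub_eq_zero.1 h
      exact Or.inr ⟨1, by rw [hadj]; module⟩

end TwoByTwo

namespace PGL2

variable {F : Type*} [Field F]

lemma mk_eq_one_iff {A : GL (Fin 2) F} :
    (A : PGL2 F) = 1 ↔ ∃ c : F, A.val = c • 1 := by
  rw [QuotientGroup.eq_one_iff, Matrix.GeneralLinearGroup.mem_center_iff_val_mem_range_scalar]
  simp [Matrix.smul_one_eq_diagonal, Set.mem_range, eq_comm]

lemma mk_eq_mk_of_val_eq_smul {A B : GL (Fin 2) F} {c : F} (h : A.val = c • B.val) :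
    (A : PGL2 F) = B := by
  rw [eq_comm, ← inv_mul_eq_one, ← QuotientGroup.mk_inv, ← QuotientGroup.mk_mul, mk_eq_one_iff]
  refine ⟨c, ?_⟩
  rw [Units.val_mul, h, mul_smul_comm, Units.inv_mul]

/-- If an element of odd order of `PGL₂(F)` commutes with another one, so do their lifts. -/
lemma commute_of_commute_mk {A B : GL (Fin 2) F} {m : ℕ} (hm : Odd m)
    (hA : (A : PGL2 F) ^ m = 1) (h : Commute (A : PGL2 F) B) : Commute A B := by
  have hz : A⁻¹ * (B * A * B⁻¹) ∈ center (GL (Fin 2) F) := by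
    rw [← QuotientGroup.eq]
    simp only [QuotientGroup.mk_mul, QuotientGroup.mk_inv]
    rw [← h.eq, mul_inv_cancel_right]
  rw [Matrix.GeneralLinearGroup.center_eq_range_scalar] at hz
  obtain ⟨u, hu⟩ := hz
  have hBA : B * A * B⁻¹ = A * Matrix.GeneralLinearGroup.scalar (Fin 2) u := by
    rw [hu, mul_inv_cancel_left]
  have hu2 : u ^ 2 = 1 := by
    have := congrArg Matrix.GeneralLinearGroup.det hBA
    simp only [map_mul, map_inv] at this
    rw [mul_right_comm, mul_inv_cancel, one_mul, left_eq_mul] at this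
    simpa [Units.ext_iff, pow_two] using this
  have hum : u ^ m = 1 := by
    have hAm : A ^ m ∈ center (GL (Fin 2) F) := by
      rwa [← QuotientGroup.eq_one_iff, QuotientGroup.mk_pow]
    have := congrArg (· ^ m) hBA
    simp only [conj_pow] at this
    rw [Commute.mul_pow (Matrix.GeneralLinearGroup.scalar_commute u A).symm,
      mem_center_iff.1 hAm B, mul_inv_cancel_right, left_eq_mul, ← map_pow] at this
    have h00 := congrArg (fun g : GL (Fin 2) F => g.val 0 0) this
    exact Units.ext (by simpa [Matrix.diagonal_pow] using h00)
  have hu1 : u = 1 := by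
    obtain ⟨k, rfl⟩ := hm
    simpa [pow_add, pow_mul, hu2] using hum
  rw [hu1, map_one, mul_one, mul_inv_eq_iff_eq_mul] at hBA
  exact hBA.symm

lemma exists_val_eq_of_commute_mk {A B : GL (Fin 2) F} {m : ℕ} (hm : Odd m)
    (hA : (A : PGL2 F) ^ m = 1) (hA1 : (A : PGL2 F) ≠ 1) (h : Commute (A : PGL2 F) B) :
    ∃ a b : F, B.val = a • 1 + b • A.val :=
  exists_eq_smul_one_add_smul_of_commute (fun c hc => hA1 (mk_eq_one_iff.2 ⟨c, hc⟩))
    (congrArg Units.val (commute_of_commute_mk hm hA h).eq)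

/-- For odd `q`, the `q`-subgroups of `PGL₂(F)` are commutative. -/
lemma commute_of_isPGroup [Finite F] {q : ℕ} [Fact q.Prime] (hq : Odd q) {P : Subgroup (PGL2 F)}
    (hP : IsPGroup q P) {x y : PGL2 F} (hx : x ∈ P) (hy : y ∈ P) : Commute x y := by
  rcases subsingleton_or_nontrivial P with hs | hn
  · have := congrArg Subtype.val (Subsingleton.elim (⟨x, hx⟩ : P) ⟨y, hy⟩)
    simp only at this
    rw [this]
  have := hP.center_nontrivial
  obtain ⟨⟨⟨z, hzP⟩, hzc⟩, hz1⟩ := exists_ne (1 : center P)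
  have hz1' : z ≠ 1 := fun h => hz1 (Subtype.ext (Subtype.ext h))
  have hcomm : ∀ w ∈ P, Commute z w := fun w hw =>
    (congrArg Subtype.val (mem_center_iff.1 hzc ⟨w, hw⟩)).symm
  obtain ⟨k, hk⟩ := hP ⟨z, hzP⟩
  have hk' : z ^ q ^ k = 1 := congrArg Subtype.val hk
  obtain ⟨Z, rfl⟩ := QuotientGroup.mk_surjective z
  obtain ⟨X, rfl⟩ := QuotientGroup.mk_surjective x
  obtain ⟨Y, rfl⟩ := QuotientGroup.mk_surjective y
  obtain ⟨a, b, hX⟩ := exists_val_eq_of_commute_mk hq.pow hk' hz1' (hcomm _ hx)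
  obtain ⟨c, d, hY⟩ := exists_val_eq_of_commute_mk hq.pow hk' hz1' (hcomm _ hy)
  have hXY : X * Y = Y * X := by
    ext1
    rw [Units.val_mul, Units.val_mul, hX, hY]
    simp only [add_mul, mul_add, smul_mul_assoc, mul_smul_comm, one_mul, mul_one]
    module
  change (X : PGL2 F) * Y = Y * X
  rw [← QuotientGroup.mk_mul, hXY, QuotientGroup.mk_mul]

/-- In `PGL₂` of a finite field of characteristic `p`, a conjugate of `x` lying in the same
`q`-subgroup as `x`, with `q ≠ p` odd, is `x` or `x⁻¹`. -/
lemma conj_eq_or_eq_inv [Finite F] {p q : ℕ} [Fact p.Prime] [CharP F p] [Fact q.Prime]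
    (hq : Odd q) (hpq : p ≠ q) {P : Subgroup (PGL2 F)} (hP : IsPGroup q P) {x n : PGL2 F}
    (hx : x ∈ P) (hn : n * x * n⁻¹ ∈ P) : n * x * n⁻¹ = x ∨ n * x * n⁻¹ = x⁻¹ := by
  rcases eq_or_ne x 1 with rfl | hx1
  · simp
  have hcomm := commute_of_isPGroup hq hP hx hn
  obtain ⟨k, hk⟩ := hP ⟨x, hx⟩
  have hk' : x ^ q ^ k = 1 := congrArg Subtype.val hk
  obtain ⟨A, rfl⟩ := QuotientGroup.mk_surjective x
  obtain ⟨B, rfl⟩ := QuotientGroup.mk_surjective n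
  rw [← QuotientGroup.mk_inv, ← QuotientGroup.mk_mul, ← QuotientGroup.mk_mul] at hcomm ⊢
  obtain ⟨a, b, hab⟩ := exists_val_eq_of_commute_mk hq.pow hk' hx1 hcomm
  have htr : (B * A * B⁻¹).val.trace = A.val.trace := by
    rw [Units.val_mul, Matrix.trace_mul_comm, ← Units.val_mul, ← mul_assoc, inv_mul_cancel,
      one_mul]
  have hdet : (B * A * B⁻¹).val.det = A.val.det := by
    rw [Units.val_mul, Matrix.det_mul_comm, ← Units.val_mul, ← mul_assoc, inv_mul_cancel,
      one_mul]
  have hdisc : A.val.trace ^ 2 ≠ 4 * A.val.det := by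
    intro h
    obtain ⟨c, hc⟩ := exists_pow_char_eq_smul_one (p := p) h
    have hp1 : (A : PGL2 F) ^ p = 1 := by
      rw [← QuotientGroup.mk_pow, mk_eq_one_iff]
      exact ⟨c, by rw [Units.val_pow_eq_pow_val, hc]⟩
    have hcop : Nat.gcd p (q ^ k) = 1 :=
      ((Nat.coprime_primes Fact.out Fact.out).2 hpq).pow_right k
    have := Nat.dvd_gcd (orderOf_dvd_of_pow_eq_one hp1) (orderOf_dvd_of_pow_eq_one hk')
    rw [hcop, Nat.dvd_one, orderOf_eq_one_iff] at this
    exact hx1 this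
  rw [hab] at htr hdet
  rcases smul_one_add_smul_cases hdisc htr hdet with ⟨c, hc⟩ | ⟨c, hc⟩
  · exact Or.inl (mk_eq_mk_of_val_eq_smul (hab.trans hc))
  · right
    rw [← QuotientGroup.mk_inv]
    refine mk_eq_mk_of_val_eq_smul (c := c * A.val.det) ((hab.trans hc).trans ?_)
    have hu : IsUnit A.val.det := (Matrix.isUnit_iff_isUnit_det _).1 A.isUnit
    rw [Matrix.coe_units_inv, Matrix.inv_def, smul_smul, mul_assoc, Ring.mul_inverse_cancel _ hu,
      mul_one]

end PGL2

/-- Frattini's argument along a surjection `f : G → Q`: if `u` has `q`-power order and generates a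
normal subgroup of `Q`, then conjugation of `u` by `d` lifts to the conjugation of an element of a
`q`-subgroup by an element of its normalizer. -/
lemma exists_isPGroup_lift_of_normal {G Q : Type*} [Group G] [Finite G] [Group Q] {q : ℕ}
    [Fact q.Prime] {f : G →* Q} (hf : Function.Surjective f) {u : Q} [(zpowers u).Normal]
    (hu : IsPGroup q (zpowers u)) (d : Q) :
    ∃ (P : Subgroup G) (x n : G), IsPGroup q P ∧ x ∈ P ∧ n * x * n⁻¹ ∈ P ∧ f x = u ∧
      f (n * x * n⁻¹) = d * u * d⁻¹ := by
  have hK := f.subgroupComap_surjective_of_surjective (zpowers u) hf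
  obtain ⟨S⟩ : Nonempty (Sylow q ((zpowers u).comap f)) := inferInstance
  have hS : (S.mapSurjective hK : Subgroup (zpowers u)) = ⊤ := by
    have := (S.mapSurjective hK).is_maximal' (Q := ⊤) (hu.of_equiv topEquiv.symm) le_top
    exact this.symm
  obtain ⟨⟨x, hxK⟩, hxS, hx⟩ : (⟨u, mem_zpowers u⟩ : zpowers u) ∈
      (S : Subgroup ((zpowers u).comap f)).map (f.subgroupComap (zpowers u)) := by
    rw [← Sylow.coe_mapSurjective hK, hS]
    trivial
  have hfx : f x = u := congrArg Subtype.val hx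
  obtain ⟨e, rfl⟩ := hf d
  have he : e ∈ normalizer ((S : Subgroup ((zpowers u).comap f)).map
      ((zpowers u).comap f).subtype : Set G) ⊔ (zpowers u).comap f := by
    rw [Sylow.normalizer_sup_eq_top]
    trivial
  obtain ⟨n, hn, k, hk, rfl⟩ := mem_sup_of_normal_right.1 he
  have hxP : x ∈ (S : Subgroup ((zpowers u).comap f)).map ((zpowers u).comap f).subtype :=
    ⟨⟨x, hxK⟩, hxS, rfl⟩
  refine ⟨_, x, n, S.isPGroup'.map _, hxP, (mem_normalizer_iff.1 hn x).1 hxP, hfx, ?_⟩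
  obtain ⟨j, hj⟩ := hk
  have hku : f k * u * (f k)⁻¹ = u := by
    rw [← hj]
    group
  rw [map_mul f n k]
  calc f (n * x * n⁻¹) = f n * (f k * u * (f k)⁻¹) * (f n)⁻¹ := by simp [hku, hfx]
    _ = f n * f k * u * (f n * f k)⁻¹ := by group

lemma exists_isPGroup_lift {G Q : Type*} [Group G] [Finite G] [Group Q] {q : ℕ}
    [Fact q.Prime] {f : G →* Q} (hf : Function.Surjective f) {u d : Q}
    (hu : IsPGroup q (zpowers u)) (hd : d ∈ normalizer (zpowers u : Set Q)) :
    ∃ (P : Subgroup G) (x n : G), IsPGroup q P ∧ x ∈ P ∧ n * x * n⁻¹ ∈ P ∧ f x = u ∧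
      f (n * x * n⁻¹) = d * u * d⁻¹ := by
  set H := normalizer (zpowers u : Set Q) with hH
  have huH : u ∈ H := le_normalizer (mem_zpowers u)
  have hz : zpowers (⟨u, huH⟩ : H) = (zpowers u).subgroupOf H := by
    refine map_injective H.subtype_injective ?_
    rw [MonoidHom.map_zpowers, subgroupOf_map_subtype, inf_of_le_left le_normalizer]
    rfl
  have : (zpowers (⟨u, huH⟩ : H)).Normal := by
    rw [hz]
    infer_instance
  have hu' : IsPGroup q (zpowers (⟨u, huH⟩ : H)) := by
    rw [hz]
    exact hu.comap_of_injective _ H.subtype_injective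
  obtain ⟨P, x, n, hP, hx, hn, hfx, hfn⟩ := exists_isPGroup_lift_of_normal
    (f.subgroupComap_surjective_of_surjective H hf) hu' ⟨d, hd⟩
  exact ⟨P.map (H.comap f).subtype, x, n, hP.map _, ⟨x, hx, rfl⟩, ⟨_, hn, rfl⟩,
    congrArg Subtype.val hfx, congrArg Subtype.val hfn⟩

/-- `PGL₂(ℤ/5ℤ)` contains a Frobenius group of order `20`. -/
lemma exists_conj_eq_sq_pgl2_five :
    ∃ u d : PGL2 (ZMod 5), orderOf u = 5 ∧ d * u * d⁻¹ = u ^ 2 := by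
  let U : GL (Fin 2) (ZMod 5) := ⟨!![1, 1; 0, 1], !![1, -1; 0, 1], by decide, by decide⟩
  let D : GL (Fin 2) (ZMod 5) := ⟨!![2, 0; 0, 1], !![3, 0; 0, 1], by decide, by decide⟩
  refine ⟨U, D, ?_, ?_⟩
  · have : Fact (Nat.Prime 5) := ⟨Nat.prime_five⟩
    refine orderOf_eq_prime ?_ ?_
    · rw [← QuotientGroup.mk_pow, show U ^ 5 = 1 by ext1; decide]
      rfl
    · rw [Ne, PGL2.mk_eq_one_iff]
      rintro ⟨c, hc⟩
      simpa [U] using congrFun (congrFun hc 0) 1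
  · rw [← QuotientGroup.mk_inv, ← QuotientGroup.mk_mul, ← QuotientGroup.mk_mul,
      ← QuotientGroup.mk_pow, show D * U * D⁻¹ = U ^ 2 by ext1; decide]

/-- If `p` is a prime and `PGL₂(ℤ/pℤ)` has a subquotient isomorphic to
`PGL₂(ℤ/5ℤ)`, then `p = 5`. -/
theorem eq_five_of_pgl2_subquotient (p : ℕ) (hp : p.Prime)
    (h : IsSubquotient (PGL2 (ZMod p)) (PGL2 (ZMod 5))) : p = 5 := by
  by_contra hp5
  have : Fact p.Prime := ⟨hp⟩
  have : Fact (Nat.Prime 5) := ⟨Nat.prime_five⟩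
  obtain ⟨G, N, hN, ⟨e⟩⟩ := h
  obtain ⟨u, d, hu, hd⟩ := exists_conj_eq_sq_pgl2_five
  let f : G →* PGL2 (ZMod 5) := e.toMonoidHom.comp (QuotientGroup.mk' N)
  have hf : Function.Surjective f := e.surjective.comp (QuotientGroup.mk'_surjective N)
  have huP : IsPGroup 5 (zpowers u) :=
    IsPGroup.of_card (n := 1) (by rw [Nat.card_zpowers, hu, pow_one])
  have hdn : d ∈ normalizer (zpowers u : Set (PGL2 (ZMod 5))) := by
    have := Nat.finite_of_card_ne_zero (α := zpowers u) (by rw [Nat.card_zpowers, hu]; decide)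
    refine mem_normalizer_fintype ?_
    rintro _ ⟨j, rfl⟩
    exact ⟨2 * j, by simp only [← conj_zpow, hd, zpow_mul, zpow_ofNat]⟩
  obtain ⟨P, x, n, hP, hx, hn, hfx, hfn⟩ := exists_isPGroup_lift hf huP hdn
  have hcases := PGL2.conj_eq_or_eq_inv (p := p) (by decide) hp5 (hP.map G.subtype)
    (x := x) (n := n) ⟨x, hx, rfl⟩ ⟨_, hn, rfl⟩
  have hu2 : u ^ 2 = u ∨ u ^ 2 = u⁻¹ := by
    rw [← hd, ← hfn]
    refine hcases.imp (fun h => ?_) fun h => ?_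
    · rw [show n * x * n⁻¹ = x from Subtype.ext h, hfx]
    · rw [show n * x * n⁻¹ = x⁻¹ from Subtype.ext h, map_inv, hfx]
  rcases hu2 with h | h
  · have : u = 1 := by simpa [pow_two] using h
    simp [this] at hu
  · have h3 : u ^ 3 = 1 := by rw [pow_succ, h, inv_mul_cancel]
    have := orderOf_dvd_of_pow_eq_one h3
    rw [hu] at this
    omega
end
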